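/- Let k ≥ 0 and n ≥ k+2. For each j with k+2 ≤ j ≤ n and all x ∈ [a,b]: (Δ^{k+1}_n h^k_j)(x) = (k+1)/(x − x_{j−k−1}) if x ∈ (x_{j−1}, x_j], and (Δ^{k+1}_n h^k_j)(x) = 0 otherwise. -/

import Mathlib

open Finset

/-- Divided difference of `f` with respect to a list of centers:
`f[z] = f z`, and `f[z₁,…,z_{r+1}] = (f[z₂,…,z_{r+1}] − f[z₁,…,z_r]) / (z_{r+1} − z₁)`. -/
noncomputable def divDiff (f : ℝ → ℝ) : List ℝ → ℝ
  | [] => 0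
  | [z] => f z
  | z :: y :: l =>
      (divDiff f (y :: l) - divDiff f (z :: (y :: l).dropLast)) /
        ((y :: l).getLast (List.cons_ne_nil y l) - z)
  termination_by l => l.length
  decreasing_by
  · simp
  · simp [List.length_dropLast]

/-- The list of centers `x_lo, …, x_hi`. -/
noncomputable def ctrs (x : ℕ → ℝ) (lo hi : ℕ) : List ℝ :=
  (List.range (hi + 1 - lo)).map fun m => x (lo + m)

/-- The index `i` such that `t ∈ (x_i, x_{i+1}]` (equals `0` when `t ≤ x 1`,
and `n` when `t > x n`): the number of design points strictly below `t`. -/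
noncomputable def discrIdx (x : ℕ → ℝ) (n : ℕ) (t : ℝ) : ℕ :=
  ((Finset.Icc 1 n).filter fun i => x i < t).card

/-- The `k`-th order discrete derivative operator `Δ^k_n`. -/
noncomputable def discreteDeriv (x : ℕ → ℝ) (n k : ℕ) (f : ℝ → ℝ) (t : ℝ) : ℝ :=
  let i := discrIdx x n t
  if k ≤ i then (Nat.factorial k : ℝ) * divDiff f (ctrs x (i + 1 - k) i ++ [t])
  else (Nat.factorial i : ℝ) * divDiff f (ctrs x 1 i ++ [t])

/-- The simple cumulative sum operator `S̄(·; x_{lo:n})`. -/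
noncomputable def cumSum (x : ℕ → ℝ) (lo n : ℕ) (f : ℝ → ℝ) (t : ℝ) : ℝ :=
  (∑ j ∈ Finset.Icc lo n, if x j < t then f (x j) else 0) + f t

/-- The weight map `W^k_n`. -/
noncomputable def weightMap (x : ℕ → ℝ) (n k : ℕ) (f : ℝ → ℝ) (t : ℝ) : ℝ :=
  let i := discrIdx x n t
  if k ≤ i then f t * ((t - x (i + 1 - k)) / k) else f t

/-- The `k`-th order discrete integral operator `S^k_n`:
`S^0 = id`, `S^1 = S̄(·;x_{1:n}) ∘ W^1_n`, and `S^k = S^{k-1} ∘ S̄(·;x_{k:n}) ∘ W^k_n`. -/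
noncomputable def discreteInteg (x : ℕ → ℝ) (n : ℕ) : ℕ → (ℝ → ℝ) → ℝ → ℝ
  | 0, f => f
  | k + 1, f => discreteInteg x n k (cumSum x (k + 1) n (weightMap x n (k + 1) f))

/-- The `k`-th degree falling factorial basis function `h^k_j`. -/
noncomputable def fallFact (x : ℕ → ℝ) (k j : ℕ) (t : ℝ) : ℝ :=
  if j ≤ k + 1 then
    (1 / (Nat.factorial (j - 1) : ℝ)) * ∏ ℓ ∈ Finset.Icc 1 (j - 1), (t - x ℓ)
  else
    (1 / (Nat.factorial k : ℝ)) * (∏ ℓ ∈ Finset.Icc (j - k) (j - 1), (t - x ℓ)) *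
      (if x (j - 1) < t then 1 else 0)

/-- Membership in `H^k_n`, the span of the falling factorial basis, as functions on `[a,b]`. -/
def inFFSpan (x : ℕ → ℝ) (n k : ℕ) (a b : ℝ) (f : ℝ → ℝ) : Prop :=
  ∃ c : ℕ → ℝ, ∀ t ∈ Set.Icc a b, f t = ∑ j ∈ Finset.Icc 1 n, c j * fallFact x k j t

/-- Divided difference of data `v_lo, …, v_{lo+d}` over centers `x_lo, …, x_{lo+d}`. -/
noncomputable def divDiffVec (x v : ℕ → ℝ) : ℕ → ℕ → ℝ
  | lo, 0 => v lo
  | lo, d + 1 => (divDiffVec x v (lo + 1) d - divDiffVec x v lo d) / (x (lo + d + 1) - x lo)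

/-- Left derivative. -/
noncomputable def lDeriv (f : ℝ → ℝ) : ℝ → ℝ := fun t => derivWithin f (Set.Iic t) t

/-- `k`-th derivative, taken as the left derivative where the derivative does not exist. -/
noncomputable def Dk (m : ℕ) (f : ℝ → ℝ) : ℝ → ℝ := lDeriv^[m] f

lemma aux_divDiff_step (f : ℝ → ℝ) (z w : ℝ) (l : List ℝ) :
    divDiff f (z :: (l ++ [w])) =
      (divDiff f (l ++ [w]) - divDiff f (z :: l)) / (w - z) := by
  cases l with
  | nil => simp [divDiff]
  | cons y l =>
    rw [List.cons_append, divDiff]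
    have h1 : (y :: (l ++ [w])).dropLast = y :: l := by
      rw [← List.cons_append, List.dropLast_concat]
    have h2 : (y :: (l ++ [w])).getLast (List.cons_ne_nil y _) = w := by
      simp
    rw [h1, h2]

lemma aux_divDiff_zero (f : ℝ → ℝ) (m : ℕ) : ∀ l : List ℝ, l.length = m →
    (∀ z ∈ l, f z = 0) → divDiff f l = 0 := by
  induction m with
  | zero =>
    intro l hl _
    have : l = [] := List.length_eq_zero_iff.mp hl
    subst this; simp [divDiff]
  | succ m ih =>
    intro l hl h
    cases l with
    | nil => simp at hl
    | cons z l =>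
      rcases List.eq_nil_or_concat l with rfl | ⟨l', w, rfl⟩
      · simpa [divDiff] using h
      · simp only [List.concat_eq_append] at *
        rw [aux_divDiff_step, ih _ (by simpa using hl) (fun y hy => h y (by simp_all)),
          ih (z :: l') (by simpa using hl) (fun y hy => h y (by simp at hy ⊢; tauto))]
        simp

lemma aux_divDiff_last (f : ℝ → ℝ) (t : ℝ) (l : List ℝ) (h : ∀ z ∈ l, f z = 0) :
    divDiff f (l ++ [t]) = f t / (l.map fun z => t - z).prod := by
  induction l with
  | nil => simp [divDiff]
  | cons z l ih =>
    rw [List.cons_append, aux_divDiff_step, ih (fun y hy => h y (by simp [hy])),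
      aux_divDiff_zero f _ (z :: l) rfl h]
    simp [div_div, mul_comm]

open Polynomial in
lemma aux_divDiff_interp (f : ℝ → ℝ) (m : ℕ) : ∀ l : List ℝ, l.length = m + 1 → l.Nodup →
    ∃ Q : ℝ[X], Q.natDegree ≤ m ∧ (∀ z ∈ l, Q.eval z = f z) ∧ Q.coeff m = divDiff f l := by
  induction m with
  | zero =>
    intro l hl _
    obtain ⟨z, rfl⟩ := List.length_eq_one_iff.mp hl
    exact ⟨C (f z), by simp, by simp, by simp [divDiff]⟩
  | succ m ih =>
    intro l hl h
    cases l with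
    | nil => simp at hl
    | cons z l =>
      rcases List.eq_nil_or_concat l with rfl | ⟨l', w, rfl⟩
      · simp at hl
      · simp only [List.concat_eq_append] at *
        have hnd2 : (z :: l').Nodup := by
          rw [← List.cons_append] at h
          exact (List.nodup_append.mp h).1
        obtain ⟨Q1, d1, e1, c1⟩ := ih (l' ++ [w]) (by simpa using hl) (List.nodup_cons.mp h).2
        obtain ⟨Q2, d2, e2, c2⟩ := ih (z :: l') (by simpa using hl) hnd2
        have hzw : w - z ≠ 0 := by
          intro h0
          have : w = z := by linarith
          subst this
          simp at h
        refine ⟨C (w - z)⁻¹ * ((X - C z) * Q1 - (X - C w) * Q2), ?_, ?_, ?_⟩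
        · refine (natDegree_C_mul_le _ _).trans ((natDegree_sub_le _ _).trans (max_le ?_ ?_))
          · refine natDegree_mul_le.trans ?_
            rw [natDegree_X_sub_C]; omega
          · refine natDegree_mul_le.trans ?_
            rw [natDegree_X_sub_C]; omega
        · intro y hy
          simp only [eval_mul, eval_C, eval_sub, eval_X]
          by_cases hyz : y = z
          · subst hyz
            rw [e2 y (by simp)]
            field_simp
            ring
          · by_cases hyw : y = w
            · subst hyw
              rw [e1 y (by simp)]
              field_simp
              ring
            · have : y ∈ l' := by simpa [hyz, hyw] using hy
              rw [e1 y (by simp [this]), e2 y (by simp [this])]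
              field_simp
              ring
        · rw [aux_divDiff_step, ← c1, ← c2, coeff_C_mul, coeff_sub, sub_mul, sub_mul, coeff_sub,
            coeff_sub, coeff_X_mul, coeff_X_mul, coeff_C_mul, coeff_C_mul,
            coeff_eq_zero_of_natDegree_lt (by omega : Q1.natDegree < m + 1),
            coeff_eq_zero_of_natDegree_lt (by omega : Q2.natDegree < m + 1)]
          field_simp
          ring

open Polynomial in
lemma aux_divDiff_poly (f : ℝ → ℝ) (m : ℕ) (l : List ℝ) (hl : l.length = m + 1) (h : l.Nodup)
    (p : ℝ[X]) (hp : p.natDegree < m) (hpf : ∀ z ∈ l, f z = p.eval z) : divDiff f l = 0 := by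
  obtain ⟨Q, d, e, c⟩ := aux_divDiff_interp f m l hl h
  have : Q - p = 0 := by
    refine eq_zero_of_natDegree_lt_card_of_eval_eq_zero' (Q - p) l.toFinset ?_ ?_
    · intro z hz
      rw [List.mem_toFinset] at hz
      rw [eval_sub, e z hz, hpf z hz, sub_self]
    · rw [List.toFinset_card_of_nodup h, hl]
      have := natDegree_sub_le Q p
      have : max Q.natDegree p.natDegree ≤ m := by omega
      omega
  rw [← c, sub_eq_zero.mp this]
  exact coeff_eq_zero_of_natDegree_lt hp

lemma aux_mono (n : ℕ) (x : ℕ → ℝ)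
    (hmono : ∀ i, 1 ≤ i → i < n → x i < x (i + 1)) (i j : ℕ) (hi : 1 ≤ i) (hij : i < j)
    (hj : j ≤ n) : x i < x j := by
  induction j, hij using Nat.le_induction with
  | base => exact hmono i hi (by omega)
  | succ j hij ih =>
    exact (ih (by omega)).trans (hmono j (by omega) (by omega))

lemma aux_idx (n : ℕ) (x : ℕ → ℝ)
    (hmono : ∀ i, 1 ≤ i → i < n → x i < x (i + 1)) (t : ℝ) (m : ℕ) (hm : 1 ≤ m) (hmn : m ≤ n) :
    m ≤ discrIdx x n t ↔ x m < t := by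
  unfold discrIdx
  constructor
  · intro h
    by_contra hc
    have : ((Finset.Icc 1 n).filter fun i => x i < t) ⊆ Finset.Icc 1 (m - 1) := by
      intro i hi
      simp only [Finset.mem_filter, Finset.mem_Icc] at hi ⊢
      refine ⟨hi.1.1, ?_⟩
      by_contra h2
      rcases (show m ≤ i by omega).eq_or_lt with rfl | h3
      · exact hc hi.2
      · exact hc ((aux_mono n x hmono m i hm h3 hi.1.2).trans hi.2)
    have := Finset.card_le_card this
    simp at this
    omega
  · intro h
    have : Finset.Icc 1 m ⊆ ((Finset.Icc 1 n).filter fun i => x i < t) := by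
      intro i hi
      simp only [Finset.mem_filter, Finset.mem_Icc] at hi ⊢
      refine ⟨⟨hi.1, by omega⟩, ?_⟩
      rcases hi.2.eq_or_lt with rfl | h3
      · exact h
      · exact (aux_mono n x hmono i m hi.1 h3 hmn).trans h
    have := Finset.card_le_card this
    simpa using this

lemma aux_idx_le (n : ℕ) (x : ℕ → ℝ) (t : ℝ) : discrIdx x n t ≤ n := by
  unfold discrIdx
  refine (Finset.card_filter_le _ _).trans (by simp)

lemma aux_mem_ctrs (x : ℕ → ℝ) (lo hi : ℕ) (z : ℝ) (h : z ∈ ctrs x lo hi) :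
    ∃ m, lo ≤ m ∧ m ≤ hi ∧ z = x m := by
  unfold ctrs at h
  simp only [List.mem_map, List.mem_range] at h
  obtain ⟨m, h1, rfl⟩ := h
  exact ⟨lo + m, by omega, by omega, rfl⟩

/-- Lemma: `(k+1)`-st discrete derivative of the piecewise-polynomial
falling factorial basis functions.  For `j = k+2,…,n` and all `x ∈ [a,b]`:
`(Δ^{k+1}_n h^k_j)(x) = (k+1)/(x − x_{j−k−1})` if `x ∈ (x_{j−1}, x_j]`, and `0` otherwise. -/
theorem discreteDeriv_extra_order_pp
    (n k : ℕ) (a b : ℝ) (x : ℕ → ℝ)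
    (hn : k + 2 ≤ n)
    (hmono : ∀ i, 1 ≤ i → i < n → x i < x (i + 1))
    (ha : a ≤ x 1) (hb : x n ≤ b) (hab : x (n + 1) = b) :
    ∀ j ∈ Finset.Icc (k + 2) n, ∀ t ∈ Set.Icc a b,
      discreteDeriv x n (k + 1) (fallFact x k j) t =
        if x (j - 1) < t ∧ t ≤ x j then (k + 1 : ℝ) / (t - x (j - (k + 1))) else 0 := by
  intro j hj t _
  rw [Finset.mem_Icc] at hj
  have hidx := aux_idx n x hmono t
  have hile := aux_idx_le n x t
  have hM := aux_mono n x hmono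
  have hf : ∀ u, fallFact x k j u = (1 / (Nat.factorial k : ℝ)) *
      (∏ ℓ ∈ Finset.Icc (j - k) (j - 1), (u - x ℓ)) * (if x (j - 1) < u then 1 else 0) := by
    intro u
    unfold fallFact
    rw [if_neg (by omega)]
  have hf0 : ∀ u, u ≤ x (j - 1) → fallFact x k j u = 0 := by
    intro u hu
    rw [hf, if_neg (not_lt.mpr hu), mul_zero]
  have hle : ∀ m, 1 ≤ m → m ≤ j - 1 → x m ≤ x (j - 1) := by
    intro m h1 h2
    rcases h2.eq_or_lt with rfl | h3
    · exact le_rfl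
    · exact (hM m (j - 1) h1 h3 (by omega)).le
  unfold discreteDeriv
  generalize discrIdx x n t = i at *
  simp only
  by_cases h1 : x (j - 1) < t
  · have hi : j - 1 ≤ i := (hidx (j - 1) (by omega) (by omega)).mpr h1
    rw [if_pos (show k + 1 ≤ i by omega)]
    by_cases h2 : t ≤ x j
    · have hi' : i = j - 1 := by
        have := mt (hidx j (by omega) (by omega)).mp (not_lt.mpr h2)
        omega
      rw [if_pos ⟨h1, h2⟩, aux_divDiff_last, hf, if_pos h1]
      · have hprod : ((ctrs x (i + 1 - (k + 1)) i).map fun z => t - z).prod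
            = (t - x (j - (k + 1))) * ∏ ℓ ∈ Finset.Icc (j - k) (j - 1), (t - x ℓ) := by
          unfold ctrs
          rw [List.map_map, show i + 1 - (i + 1 - (k + 1)) = k + 1 by omega,
            ← List.prod_toFinset _ List.nodup_range, List.toFinset_range, Finset.prod_range_succ']
          rw [mul_comm]
          congr 1
          · simp [show i + 1 - (k + 1) = j - (k + 1) by omega]
          · refine Finset.prod_bij (fun p _ => p + (j - k)) ?_ ?_ ?_ ?_
            · intro p hp
              rw [Finset.mem_range] at hp
              rw [Finset.mem_Icc]
              omega
            · intro p _ q _ h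
              simpa using h
            · intro q hq
              rw [Finset.mem_Icc] at hq
              exact ⟨q - (j - k), by rw [Finset.mem_range]; omega, by omega⟩
            · intro p hp
              simp only [Function.comp]
              rw [show i + 1 - (k + 1) + (p + 1) = p + (j - k) by omega]
        have hne : ∀ ℓ, 1 ≤ ℓ → ℓ ≤ j - 1 → t - x ℓ ≠ 0 := by
          intro ℓ h3 h4
          have := hle ℓ h3 h4
          exact (by linarith : 0 < t - x ℓ).ne'
        have hP : ∏ ℓ ∈ Finset.Icc (j - k) (j - 1), (t - x ℓ) ≠ 0 := by
          rw [Finset.prod_ne_zero_iff]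
          intro ℓ hℓ
          rw [Finset.mem_Icc] at hℓ
          exact hne ℓ (by omega) hℓ.2
        have h0 := hne (j - (k + 1)) (by omega) (by omega)
        have hk : (Nat.factorial k : ℝ) ≠ 0 := by exact_mod_cast Nat.factorial_ne_zero k
        rw [hprod, Nat.factorial_succ]
        push_cast
        field_simp
      · intro z hz
        obtain ⟨m, hm1, hm2, rfl⟩ := aux_mem_ctrs _ _ _ _ hz
        exact hf0 _ (hle m (by omega) (by omega))
    · have hi' : j ≤ i := (hidx j (by omega) (by omega)).mpr (not_le.mp h2)
      rw [if_neg (fun h => h2 h.2)]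
      rw [aux_divDiff_poly (fallFact x k j) (k + 1) _ ?_ ?_
        (Polynomial.C (1 / (Nat.factorial k : ℝ)) *
          ∏ ℓ ∈ Finset.Icc (j - k) (j - 1), (Polynomial.X - Polynomial.C (x ℓ))) ?_ ?_, mul_zero]
      · simp [ctrs]; omega
      · rw [List.nodup_append]
        refine ⟨?_, by simp, ?_⟩
        · unfold ctrs
          refine List.Nodup.map_on ?_ List.nodup_range
          intro p hp q hq hpq
          rw [List.mem_range] at hp hq
          rcases lt_trichotomy p q with h | h | h
          · exact absurd hpq (hM _ _ (by omega) (by omega) (by omega)).ne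
          · exact h
          · exact absurd hpq (hM _ _ (by omega) (by omega) (by omega)).ne'
        · intro z hz w hw
          obtain ⟨m, hm1, hm2, rfl⟩ := aux_mem_ctrs _ _ _ _ hz
          rw [List.mem_singleton] at hw
          subst hw
          exact ((hidx m (by omega) (by omega)).mp hm2).ne
      · refine (Polynomial.natDegree_C_mul_le _ _).trans_lt ?_
        rw [Polynomial.natDegree_prod_of_monic _ _ (fun ℓ _ => Polynomial.monic_X_sub_C _)]
        simp
        omega
      · intro z hz
        rw [hf]
        simp only [Polynomial.eval_mul, Polynomial.eval_C, Polynomial.eval_prod,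
          Polynomial.eval_sub, Polynomial.eval_X]
        by_cases hc : x (j - 1) < z
        · rw [if_pos hc, mul_one]
        · rw [if_neg hc, mul_zero]
          rw [List.mem_append, List.mem_singleton] at hz
          rcases hz with hz | rfl
          · obtain ⟨m, hm1, hm2, rfl⟩ := aux_mem_ctrs _ _ _ _ hz
            have hmj : m ≤ j - 1 := by
              by_contra h3
              exact hc (hM _ _ (by omega) (by omega) (by omega))
            rw [Finset.prod_eq_zero (i := m) (Finset.mem_Icc.mpr ⟨by omega, hmj⟩) (sub_self _),
              mul_zero]
          · exact absurd h1 hc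
  · rw [if_neg (show ¬ (x (j - 1) < t ∧ t ≤ x j) from fun h => h1 h.1)]
    have hi : i < j - 1 := by
      have := mt (hidx (j - 1) (by omega) (by omega)).mp h1
      omega
    have key : ∀ lo, 1 ≤ lo → divDiff (fallFact x k j) (ctrs x lo i ++ [t]) = 0 := by
      intro lo hlo
      refine aux_divDiff_zero _ _ _ rfl ?_
      intro z hz
      rw [List.mem_append, List.mem_singleton] at hz
      rcases hz with hz | rfl
      · obtain ⟨m, hm1, hm2, rfl⟩ := aux_mem_ctrs _ _ _ _ hz
        exact hf0 _ (hle m (by omega) (by omega))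
      · exact hf0 _ (not_lt.mp h1)
    split_ifs
    · rw [key _ (by omega), mul_zero]
    · rw [key _ le_rfl, mul_zero]
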